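/- arXiv:1712.01921 — 9 statements merged into one kernel-verified Lean document; each statement's English description precedes it below -/
import Mathlib

section
/- Let A be a totally unimodular matrix over ℚ with r rows and n columns whose rank equals r, and let B be a basis of A. Then for every column index e ∉ B the fundamental circuit C(B,e) has all of its entries in {−1,0,1}, and the family {C(B,e) : e ∉ B} is a ℤ-basis of the lattice ker(A) ∩ ℤ^n (the group of integer vectors v with A·v = 0). -/
theorem aux_mulVec {r n : ℕ} (A : Matrix (Fin r) (Fin n) ℚ)
    (B : Finset (Fin n)) (hBcard : B.card = r) (w : Fin n → ℚ) (hw : ∀ i, i ∉ B → w i = 0) :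
    (A.submatrix id (fun j : Fin r => ((B.orderIsoOfFin hBcard j : B) : Fin n))).mulVec
      (fun j : Fin r => w ((B.orderIsoOfFin hBcard j : B) : Fin n)) = A.mulVec w := by
  funext k
  simp only [Matrix.mulVec, dotProduct, Matrix.submatrix_apply, id]
  refine (Equiv.sum_comp (B.orderIsoOfFin hBcard).toEquiv (fun i : B => A k i * w i)).trans ?_
  rw [Finset.sum_coe_sort B (fun i => A k i * w i)]
  apply Finset.sum_subset (Finset.subset_univ _)
  intro i _ hi
  rw [hw i hi, mul_zero]


/-- Let `A` be a totally unimodular `r × n` matrix over `ℚ` of rank `r`, and let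
`B` be a basis of `A` (an `r`-element set of column indices whose submatrix is invertible).
For `e ∉ B`, the fundamental circuit `C(B,e)` is the unique vector `v ∈ ℚ^n` with `A·v = 0`,
`v e = 1`, and support contained in `B ∪ {e}`.  Then every fundamental circuit has all entries
in `{-1,0,1}`, and the family `{C(B,e) : e ∉ B}` is a `ℤ`-basis of `ker(A) ∩ ℤ^n`. -/
theorem statement0 {r n : ℕ} (A : Matrix (Fin r) (Fin n) ℚ)
    (hTU : A.IsTotallyUnimodular) (hrank : A.rank = r)
    (B : Finset (Fin n)) (hBcard : B.card = r)
    (hBinv : IsUnit (A.submatrix id (fun j : Fin r => ((B.orderIsoOfFin hBcard j : B) : Fin n))).det)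
    (C : {e : Fin n // e ∉ B} → (Fin n → ℚ))
    (hCker : ∀ e, A.mulVec (C e) = 0)
    (hCe : ∀ e, C e e.1 = 1)
    (hCsupp : ∀ e, ∀ i : Fin n, C e i ≠ 0 → i ∈ B ∨ i = e.1) :
    (∀ e, ∀ i : Fin n, C e i ∈ ({-1, 0, 1} : Set ℚ)) ∧
    LinearIndependent ℤ C ∧
    (Submodule.span ℤ (Set.range C) : Set (Fin n → ℚ)) =
      {v : Fin n → ℚ | A.mulVec v = 0 ∧ ∀ i : Fin n, ∃ m : ℤ, v i = (m : ℚ)} := by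
  classical
  set b : Fin r → Fin n := fun j : Fin r => ((B.orderIsoOfFin hBcard j : B) : Fin n) with hb
  set M := A.submatrix id b with hM
  have hbs : ∀ i ∈ B, ∃ j, b j = i := by
    intro i hi
    refine ⟨(B.orderIsoOfFin hBcard).symm ⟨i, hi⟩, ?_⟩
    change ((B.orderIsoOfFin hBcard ((B.orderIsoOfFin hBcard).symm ⟨i, hi⟩) : B) : Fin n) = i
    rw [OrderIso.apply_symm_apply]
  have hdet0 : M.det ≠ 0 := hBinv.ne_zero
  have hTUdet : ∀ f : Fin r → Fin n, (A.submatrix id f).det ∈ ({-1, 0, 1} : Set ℚ) := by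
    intro f
    have := (Matrix.isTotallyUnimodular_iff A).1 hTU r id f
    rcases this with ⟨s, hs⟩
    rw [← hs]
    cases s <;> simp
  -- Cramer
  have hcr : ∀ x y : Fin r → ℚ, M.mulVec x = y → ∀ j, (M.updateCol j y).det = M.det * x j := by
    intro x y h j
    rw [← Matrix.cramer_apply, Matrix.cramer_eq_adjugate_mulVec, ← h, Matrix.mulVec_mulVec,
      Matrix.adjugate_mul, Matrix.smul_mulVec, Matrix.one_mulVec]
    simp
  have huniq : ∀ w : Fin n → ℚ, A.mulVec w = 0 → (∀ i, i ∉ B → w i = 0) → w = 0 := by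
    intro w hw h0
    have h1 := aux_mulVec A B hBcard w h0
    rw [hw] at h1
    have h2 := Matrix.eq_zero_of_mulVec_eq_zero hdet0 h1
    funext i
    by_cases hi : i ∈ B
    · obtain ⟨j, rfl⟩ := hbs i hi
      exact congrFun h2 j
    · exact h0 i hi
  have hoff : ∀ e e' : {e : Fin n // e ∉ B}, C e e'.1 = if e = e' then 1 else 0 := by
    intro e e'
    split_ifs with h
    · subst h; exact hCe e
    · by_contra h0
      rcases hCsupp e e'.1 h0 with h1 | h1
      · exact e'.2 h1
      · exact h (Subtype.ext h1.symm)
  have hent : ∀ e, ∀ i : Fin n, C e i ∈ ({-1, 0, 1} : Set ℚ) := by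
    intro e i
    by_cases hi : i ∈ B
    · obtain ⟨j, rfl⟩ := hbs i hi
      have h1 := aux_mulVec A B hBcard (C e - Pi.single e.1 1) (by
        intro i hi
        by_cases hie : i = e.1
        · subst hie; simp [hCe]
        · have := hoff e ⟨i, hi⟩
          rw [if_neg (fun h => hie (by rw [h]))] at this
          simp [this, hie])
      rw [Matrix.mulVec_sub, hCker, Matrix.mulVec_single_one, zero_sub] at h1
      have h2 := hcr _ _ h1 j
      have hne : b j ≠ e.1 := fun h => e.2 (h ▸ hi)
      have h3 : (M.updateCol j (-A.col e.1)).det = -(A.submatrix id (Function.update b j e.1)).det := by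
        rw [← neg_one_smul ℚ (A.col e.1), Matrix.det_updateCol_smul, neg_one_mul]
        congr 2
        ext k l
        by_cases hl : l = j
        · subst hl; simp
        · simp [hl, hM]
      have h4 : C e (b j) = ((C e - Pi.single e.1 1) : Fin n → ℚ) (b j) := by
        simp [hne]
      rw [h3] at h2
      change _ = M.det * ((C e - Pi.single e.1 1) : Fin n → ℚ) (b j) at h2
      rw [← h4] at h2
      have h5 := hTUdet b
      have h6 := hTUdet (Function.update b j e.1)
      rw [← hM] at h5
      simp only [Set.mem_insert_iff, Set.mem_singleton_iff] at h5 h6 ⊢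
      rcases h5 with h5 | h5 | h5
      · rw [h5] at h2
        rcases h6 with h6 | h6 | h6 <;> rw [h6] at h2
        · left; linarith
        · right; left; linarith
        · right; right; linarith
      · exact absurd h5 hdet0
      · rw [h5] at h2
        rcases h6 with h6 | h6 | h6 <;> rw [h6] at h2
        · right; right; linarith
        · right; left; linarith
        · left; linarith
    · rw [hoff e ⟨i, hi⟩]
      split_ifs <;> simp
  refine ⟨hent, ?_, ?_⟩
  · rw [Fintype.linearIndependent_iff]
    intro g hg e
    have := congrFun hg e.1
    simpa [Finset.sum_apply, hoff] using this
  · ext v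
    simp only [SetLike.mem_coe, Set.mem_ofPred_eq]
    constructor
    · intro hv
      induction hv using Submodule.span_induction with
      | mem x hx =>
        obtain ⟨e, rfl⟩ := hx
        refine ⟨hCker e, fun i => ?_⟩
        rcases hent e i with h | h | h
        · exact ⟨-1, by rw [h]; simp⟩
        · exact ⟨0, by rw [h]; simp⟩
        · exact ⟨1, by rw [h]; simp⟩
      | zero => exact ⟨Matrix.mulVec_zero _, fun i => ⟨0, by simp⟩⟩
      | add x y _ _ hx hy =>
        refine ⟨by rw [Matrix.mulVec_add, hx.1, hy.1, add_zero], fun i => ?_⟩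
        obtain ⟨a, ha⟩ := hx.2 i
        obtain ⟨c, hc⟩ := hy.2 i
        exact ⟨a + c, by simp [ha, hc]⟩
      | smul a x _ hx =>
        refine ⟨by rw [Matrix.mulVec_smul, hx.1, smul_zero], fun i => ?_⟩
        obtain ⟨c, hc⟩ := hx.2 i
        exact ⟨a * c, by simp [hc]⟩
    · rintro ⟨hv, hi⟩
      choose m hm using hi
      have key : v - ∑ e : {e : Fin n // e ∉ B}, m e.1 • C e = 0 := by
        apply huniq
        · rw [Matrix.mulVec_sub, hv, zero_sub, neg_eq_zero, Matrix.mulVec_sum]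
          apply Finset.sum_eq_zero
          intro e _
          rw [Matrix.mulVec_smul, hCker, smul_zero]
        · intro i hi
          have h := fun e => hoff e ⟨i, hi⟩
          simp only at h
          simp [Finset.sum_apply, h, hm]
      rw [sub_eq_zero.1 key]
      exact Submodule.sum_mem _ fun e _ =>
        Submodule.smul_mem _ _ (Submodule.subset_span ⟨e, rfl⟩)
end

section
/- Let A be a totally unimodular matrix over ℚ with r rows and n columns whose rank equals r. Then any two bases of A generate the same lattice of fundamental circuits: for all bases B₁ and B₂ of A, the ℤ-span of {C(B₁,e) : e ∉ B₁} equals the ℤ-span of {C(B₂,e) : e ∉ B₂}. -/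
lemma aux_sum {r n : ℕ} (B : Finset (Fin n)) (hc : B.card = r) (f : Fin n → ℚ) :
    ∑ j : Fin r, f ((B.orderIsoOfFin hc j : B) : Fin n) = ∑ k ∈ B, f k := by
  rw [← Finset.sum_coe_sort B f]
  exact Fintype.sum_equiv (B.orderIsoOfFin hc).toEquiv _ _ (fun _ => rfl)

lemma aux_zero {r n : ℕ} (A : Matrix (Fin r) (Fin n) ℚ)
    (B : Finset (Fin n)) (hc : B.card = r)
    (hinv : IsUnit (A.submatrix id
      (fun j : Fin r => ((B.orderIsoOfFin hc j : B) : Fin n))).det)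
    (v : Fin n → ℚ) (hv : A.mulVec v = 0) (hs : ∀ i, i ∉ B → v i = 0) : v = 0 := by
  have h : (A.submatrix id (fun j : Fin r => ((B.orderIsoOfFin hc j : B) : Fin n))).mulVec
      (fun j => v (B.orderIsoOfFin hc j : B)) = 0 := by
    rw [← hv]
    ext i
    simp only [Matrix.mulVec, dotProduct, Matrix.submatrix_apply, id]
    rw [aux_sum B hc (fun k => A i k * v k)]
    apply Finset.sum_subset (Finset.subset_univ B)
    intro k _ hk
    rw [hs k hk, mul_zero]
  have h2 := Matrix.eq_zero_of_mulVec_eq_zero hinv.ne_zero h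
  ext i
  by_cases hi : i ∈ B
  · have := congrFun h2 ((B.orderIsoOfFin hc).symm ⟨i, hi⟩)
    simpa using this
  · exact hs i hi

lemma aux_int {r n : ℕ} (A : Matrix (Fin r) (Fin n) ℚ)
    (hTU : A.IsTotallyUnimodular)
    (B : Finset (Fin n)) (hc : B.card = r)
    (hinv : IsUnit (A.submatrix id
      (fun j : Fin r => ((B.orderIsoOfFin hc j : B) : Fin n))).det)
    (e : Fin n) (he : e ∉ B) (v : Fin n → ℚ) (hv : A.mulVec v = 0) (h1 : v e = 1)
    (hs : ∀ i, v i ≠ 0 → i ∈ B ∨ i = e) (i : Fin n) : ∃ z : ℤ, v i = z := by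
  by_cases hi : i ∈ B
  swap
  · by_cases h0 : v i = 0
    · exact ⟨0, by simpa using h0⟩
    · rcases hs i h0 with h | h
      · exact absurd h hi
      · exact ⟨1, by simp [h, h1]⟩
  set g : Fin r → Fin n := fun j => ((B.orderIsoOfFin hc j : B) : Fin n) with hg
  have h : (A.submatrix id g).mulVec (fun j => v (g j)) = fun i => - A i e := by
    ext i
    have hz := congrFun hv i
    simp only [Matrix.mulVec, dotProduct, Pi.zero_apply] at hz
    simp only [Matrix.mulVec, dotProduct, Matrix.submatrix_apply, id, hg]
    rw [aux_sum B hc (fun k => A i k * v k)]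
    have : ∑ k ∈ insert e B, A i k * v k = ∑ k, A i k * v k := by
      apply Finset.sum_subset (Finset.subset_univ _)
      intro k _ hk
      have : v k = 0 := by
        by_contra hne
        rcases hs k hne with h | h <;> simp [h] at hk
      rw [this, mul_zero]
    rw [hz, Finset.sum_insert he, h1] at this
    linarith
  obtain ⟨j, rfl⟩ : ∃ j, g j = i := ⟨(B.orderIsoOfFin hc).symm ⟨i, hi⟩,
    congrArg Subtype.val ((B.orderIsoOfFin hc).apply_symm_apply ⟨i, hi⟩)⟩
  have hcr : (A.submatrix id g).det * v (g j)
      = - (A.submatrix id (Function.update g j e)).det := by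
    have h3 : (A.submatrix id g).adjugate.mulVec ((A.submatrix id g).mulVec (fun j => v (g j)))
        = (A.submatrix id g).det • (fun j => v (g j)) := by
      rw [Matrix.mulVec_mulVec, Matrix.adjugate_mul, Matrix.smul_mulVec, Matrix.one_mulVec]
    rw [h, ← Matrix.cramer_eq_adjugate_mulVec] at h3
    have h4 := congrFun h3 j
    rw [Matrix.cramer_apply] at h4
    simp only [Pi.smul_apply, smul_eq_mul] at h4
    rw [← h4]
    have : (fun i => - A i e) = (-1 : ℚ) • (fun i => A i e) := by ext; simp
    rw [this, Matrix.det_updateCol_smul]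
    have : (A.submatrix id g).updateCol j (fun i => A i e)
        = A.submatrix id (Function.update g j e) := by
      ext a b
      by_cases hb : b = j
      · subst hb; simp
      · simp [Matrix.updateCol_ne, hb]
    rw [this]; ring
  rw [Matrix.isTotallyUnimodular_iff] at hTU
  obtain ⟨s, hs'⟩ := hTU r id g
  obtain ⟨t, ht⟩ := hTU r id (Function.update g j e)
  have hne := hinv.ne_zero
  rw [← hs'] at hcr hne
  rw [← ht] at hcr
  cases s <;> cases t <;> simp at hcr hne
  all_goals first
    | exact ⟨0, by push_cast; linarith⟩
    | exact ⟨1, by push_cast; linarith⟩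
    | exact ⟨-1, by push_cast; linarith⟩

lemma aux_le {r n : ℕ} (A : Matrix (Fin r) (Fin n) ℚ)
    (B : Finset (Fin n)) (hc : B.card = r)
    (hinv : IsUnit (A.submatrix id
      (fun j : Fin r => ((B.orderIsoOfFin hc j : B) : Fin n))).det)
    (C : {e : Fin n // e ∉ B} → (Fin n → ℚ))
    (hker : ∀ e, A.mulVec (C e) = 0)
    (h1 : ∀ e, C e e.1 = 1)
    (hs : ∀ e, ∀ i : Fin n, C e i ≠ 0 → i ∈ B ∨ i = e.1)
    (v : Fin n → ℚ) (hv : A.mulVec v = 0) (hz : ∀ i, ∃ z : ℤ, v i = z) :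
    v ∈ Submodule.span ℤ (Set.range C) := by
  choose z hz using hz
  have : v - ∑ e : {e : Fin n // e ∉ B}, z e.1 • C e = 0 := by
    apply aux_zero A B hc hinv
    · rw [Matrix.mulVec_sub, hv, Matrix.mulVec_sum, zero_sub, neg_eq_zero]
      apply Finset.sum_eq_zero
      intro e _
      rw [Matrix.mulVec_smul, hker, smul_zero]
    · intro i hi
      simp only [Pi.sub_apply, Finset.sum_apply, Pi.smul_apply]
      rw [Finset.sum_eq_single ⟨i, hi⟩]
      · have := h1 ⟨i, hi⟩
        simp only at this
        rw [this, hz i]; simp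
      · intro e _ hne
        have : C e i = 0 := by
          by_contra h
          rcases hs e i h with h | h
          · exact hi h
          · exact hne (Subtype.ext h.symm)
        rw [this, smul_zero]
      · simp
  rw [sub_eq_zero.mp this]
  exact Submodule.sum_mem _ fun e _ =>
    Submodule.smul_mem _ _ (Submodule.subset_span ⟨e, rfl⟩)

/-- Let `A` be a totally unimodular `r × n` matrix over `ℚ` of rank `r`.  Then any
two bases `B₁`, `B₂` of `A` generate the same lattice of fundamental circuits: the `ℤ`-span of
`{C(B₁,e) : e ∉ B₁}` equals the `ℤ`-span of `{C(B₂,e) : e ∉ B₂}`. -/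
theorem statement1 {r n : ℕ} (A : Matrix (Fin r) (Fin n) ℚ)
    (hTU : A.IsTotallyUnimodular) (hrank : A.rank = r)
    (B₁ B₂ : Finset (Fin n)) (hB₁card : B₁.card = r) (hB₂card : B₂.card = r)
    (hB₁inv : IsUnit (A.submatrix id
      (fun j : Fin r => ((B₁.orderIsoOfFin hB₁card j : B₁) : Fin n))).det)
    (hB₂inv : IsUnit (A.submatrix id
      (fun j : Fin r => ((B₂.orderIsoOfFin hB₂card j : B₂) : Fin n))).det)
    (C₁ : {e : Fin n // e ∉ B₁} → (Fin n → ℚ))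
    (C₂ : {e : Fin n // e ∉ B₂} → (Fin n → ℚ))
    (hC₁ker : ∀ e, A.mulVec (C₁ e) = 0)
    (hC₁e : ∀ e, C₁ e e.1 = 1)
    (hC₁supp : ∀ e, ∀ i : Fin n, C₁ e i ≠ 0 → i ∈ B₁ ∨ i = e.1)
    (hC₂ker : ∀ e, A.mulVec (C₂ e) = 0)
    (hC₂e : ∀ e, C₂ e e.1 = 1)
    (hC₂supp : ∀ e, ∀ i : Fin n, C₂ e i ≠ 0 → i ∈ B₂ ∨ i = e.1) :
    Submodule.span ℤ (Set.range C₁) = Submodule.span ℤ (Set.range C₂) := by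
  apply le_antisymm <;> rw [Submodule.span_le] <;> rintro _ ⟨e, rfl⟩
  · exact aux_le A B₂ hB₂card hB₂inv C₂ hC₂ker hC₂e hC₂supp _ (hC₁ker e)
      (aux_int A hTU B₁ hB₁card hB₁inv e.1 e.2 _ (hC₁ker e) (hC₁e e) (hC₁supp e))
  · exact aux_le A B₁ hB₁card hB₁inv C₁ hC₁ker hC₁e hC₁supp _ (hC₂ker e)
      (aux_int A hTU B₂ hB₂card hB₂inv e.1 e.2 _ (hC₂ker e) (hC₂e e) (hC₂supp e))
end

section
/- Let A be a totally unimodular matrix over ℚ with r rows and n columns whose rank equals r. Then the subgroup of ℤ^n generated by all support-minimal nonzero elements of ker(A) ∩ ℤ^n equals ker(A) ∩ ℤ^n itself; in particular this subgroup is free abelian of rank n − r, the corank of the represented matroid. -/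
/-- A nonzero integer vector in the kernel of the rational matrix `A` is support-minimal if no
nonzero integer kernel vector has support properly contained in its support. -/
def IsSupportMinimalKerVec {r n : ℕ} (A : Matrix (Fin r) (Fin n) ℚ) (v : Fin n → ℤ) : Prop :=
  v ≠ 0 ∧ A.mulVec (fun i => (v i : ℚ)) = 0 ∧
    ∀ w : Fin n → ℤ, w ≠ 0 → A.mulVec (fun i => (w i : ℚ)) = 0 →
      ¬ (Function.support w ⊂ Function.support v)

theorem aux_mulVec_extend {r n : ℕ} (A : Matrix (Fin r) (Fin n) ℤ) (g : Fin r → Fin n)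
    (hg : Function.Injective g) (w : Fin n → ℤ) (hw : ∀ i, i ∉ Set.range g → w i = 0) :
    A.mulVec w = (A.submatrix id g).mulVec (w ∘ g) := by
  ext k
  simp only [Matrix.mulVec, dotProduct]
  symm
  apply Fintype.sum_of_injective g hg
  · intro i hi
    rw [hw i hi, mul_zero]
  · intro i
    rfl

theorem aux_basis {r n : ℕ} (A : Matrix (Fin r) (Fin n) ℚ)
    (hrank : A.rank = r) : ∃ g : Fin r → Fin n, Function.Injective g ∧
      (A.submatrix id g).det ≠ 0 := by
  obtain ⟨f, hf, -, hli⟩ := Submodule.exists_fun_fin_finrank_span_eq ℚ (Set.range A.col)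
  have hr : r = Module.finrank ℚ (Submodule.span ℚ (Set.range A.col)) := by
    rw [← Matrix.rank_eq_finrank_span_cols, hrank]
  obtain ⟨f, hf, hli⟩ : ∃ f : Fin r → (Fin r → ℚ), (∀ i, f i ∈ Set.range A.col) ∧
      LinearIndependent ℚ f :=
    ⟨f ∘ Fin.cast hr, fun i => hf _, hli.comp _ (Fin.cast_injective hr)⟩
  choose g hg using hf
  have hli2 : LinearIndependent ℚ (A.submatrix id g).col := by
    have : (A.submatrix id g).col = f := by
      ext i k
      rw [← hg i]
      rfl
    rwa [this]
  refine ⟨g, ?_, ?_⟩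
  · intro a b hab
    apply hli.injective
    rw [← hg a, ← hg b, hab]
  · have := Matrix.linearIndependent_cols_iff_isUnit.mp hli2
    exact ((Matrix.isUnit_iff_isUnit_det _).mp this).ne_zero

theorem aux_int_s2 {r n : ℕ} (A : Matrix (Fin r) (Fin n) ℚ)
    (hTU : A.IsTotallyUnimodular) (hrank : A.rank = r) :
    ∃ (Z : Matrix (Fin r) (Fin n) ℤ) (g : Fin r → Fin n), Function.Injective g ∧
      IsUnit (Z.submatrix id g).det ∧
      ∀ v : Fin n → ℤ, A.mulVec (fun i => (v i : ℚ)) = 0 ↔ Z.mulVec v = 0 := by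
  obtain ⟨g, hg, hd⟩ := aux_basis A hrank
  have h1 : ∀ i j, ∃ z : ℤ, (z : ℚ) = A i j := by
    intro i j
    obtain ⟨s, hs⟩ := hTU.apply i j
    refine ⟨(s : ℤ), ?_⟩
    rw [← hs]
    cases s <;> simp
  choose Z hZ using h1
  have hA : A = (Matrix.of Z).map (Int.castRingHom ℚ) := by
    ext i j
    simp [hZ]
  refine ⟨Matrix.of Z, g, hg, ?_, ?_⟩
  · obtain ⟨s, hs⟩ := (Matrix.isTotallyUnimodular_iff A).mp hTU r id g
    have h2 : (A.submatrix id g).det = (((Matrix.of Z).submatrix id g).det : ℚ) := by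
      have h3 : A.submatrix id g =
          (Int.castRingHom ℚ).mapMatrix ((Matrix.of Z).submatrix id g) := by
        rw [hA]
        rfl
      rw [h3, ← RingHom.map_det]
      rfl
    rw [h2] at hs hd
    rw [Int.isUnit_iff]
    cases s
    · exact absurd hs.symm (by simpa using hd)
    · right
      simp only [SignType.neg_eq_neg_one, SignType.coe_neg_one] at hs
      exact_mod_cast hs.symm
    · left
      simp only [SignType.pos_eq_one, SignType.coe_one] at hs
      exact_mod_cast hs.symm
  · intro v
    have h3 : A.mulVec (fun i => (v i : ℚ)) = fun i => (((Matrix.of Z).mulVec v i : ℤ) : ℚ) := by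
      ext i
      simp [Matrix.mulVec, dotProduct, hZ]
    rw [h3, funext_iff, funext_iff]
    simp

theorem statement2 {r n : ℕ} (A : Matrix (Fin r) (Fin n) ℚ)
    (hTU : A.IsTotallyUnimodular) (hrank : A.rank = r) :
    (Submodule.span ℤ {v : Fin n → ℤ | IsSupportMinimalKerVec A v} : Set (Fin n → ℤ)) =
      {v : Fin n → ℤ | A.mulVec (fun i => (v i : ℚ)) = 0} ∧
    Module.Free ℤ (Submodule.span ℤ {v : Fin n → ℤ | IsSupportMinimalKerVec A v}) ∧
    Module.finrank ℤ (Submodule.span ℤ {v : Fin n → ℤ | IsSupportMinimalKerVec A v}) = n - r := by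
  classical
  obtain ⟨Z, g, hg, hu, hk⟩ := aux_int_s2 A hTU hrank
  set M := Z.submatrix id g with hM
  -- kernel vectors vanishing off the basis are zero
  have key : ∀ w : Fin n → ℤ, Z.mulVec w = 0 → (∀ i, i ∉ Set.range g → w i = 0) → w = 0 := by
    intro w hw h0
    rw [aux_mulVec_extend Z g hg w h0] at hw
    have h1 : w ∘ g = 0 := by
      have := congrArg (M⁻¹).mulVec hw
      rwa [Matrix.mulVec_mulVec, Matrix.nonsing_inv_mul _ hu, Matrix.one_mulVec,
        Matrix.mulVec_zero] at this
    ext i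
    by_cases hi : i ∈ Set.range g
    · obtain ⟨b, rfl⟩ := hi
      exact congrFun h1 b
    · exact h0 i hi
  -- every vector off the basis extends to the kernel
  have ext : ∀ x : Fin n → ℤ, ∃ w : Fin n → ℤ, Z.mulVec w = 0 ∧
      ∀ i, i ∉ Set.range g → w i = x i := by
    intro x
    refine ⟨x - Function.extend g ((M⁻¹).mulVec (Z.mulVec x)) 0, ?_, ?_⟩
    · rw [Matrix.mulVec_sub, aux_mulVec_extend Z g hg (Function.extend g _ 0), Function.extend_comp hg,
        Matrix.mulVec_mulVec, Matrix.mul_nonsing_inv _ hu, Matrix.one_mulVec, sub_self]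
      intro i hi
      rw [Function.extend_apply' _ _ _ hi]
      rfl
    · intro i hi
      rw [Pi.sub_apply, Function.extend_apply' _ _ _ hi]
      simp
  choose c hc0 hc using fun j : Fin n => ext (Pi.single j 1)
  have hmin : ∀ j, j ∉ Set.range g → IsSupportMinimalKerVec A (c j) := by
    intro j hj
    have hjj : c j j = 1 := by rw [hc j j hj]; simp
    refine ⟨?_, (hk _).mpr (hc0 j), ?_⟩
    · intro h
      rw [h] at hjj
      simp at hjj
    · intro w hw0 hw hss
      rw [hk] at hw
      have heq : w = w j • c j := by
        rw [← sub_eq_zero]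
        apply key
        · rw [Matrix.mulVec_sub, Matrix.mulVec_smul, hc0, hw]
          simp
        · intro i hi
          by_cases hij : i = j
          · subst hij
            simp [hjj]
          · have h1 : c j i = 0 := by rw [hc j i hi]; simp [hij]
            have h2 : w i = 0 := by
              by_contra h
              exact (hss.1 h) h1
            simp [h1, h2]
      have hwj : w j ≠ 0 := by
        intro h
        rw [h, zero_smul] at heq
        exact hw0 heq
      apply hss.2
      intro i hi
      rw [Function.mem_support] at *
      rw [heq]
      simpa using ⟨hwj, hi⟩
  have hspan : Submodule.span ℤ {v : Fin n → ℤ | IsSupportMinimalKerVec A v} =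
      LinearMap.ker Z.mulVecLin := by
    apply le_antisymm
    · rw [Submodule.span_le]
      intro v hv
      exact (hk v).mp hv.2.1
    · intro v hv
      have hv : Z.mulVec v = 0 := hv
      have heq : v = ∑ j ∈ Finset.univ.filter (fun j => j ∉ Set.range g), v j • c j := by
        rw [← sub_eq_zero]
        apply key
        · rw [Matrix.mulVec_sub, hv, Matrix.mulVec_sum]
          rw [zero_sub, neg_eq_zero]
          apply Finset.sum_eq_zero
          intro j _
          rw [Matrix.mulVec_smul, hc0, smul_zero]
        · intro i hi
          rw [Pi.sub_apply, Finset.sum_apply, Finset.sum_eq_single i]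
          · simp [hc i i hi]
          · intro j _ hji
            simp [hc j i hi, hji.symm]
          · intro h
            exact absurd (by simpa using hi) h
      rw [heq]
      apply Submodule.sum_mem
      intro j hj
      apply Submodule.smul_mem
      apply Submodule.subset_span
      exact hmin j (Finset.mem_filter.mp hj).2
  refine ⟨?_, inferInstance, ?_⟩
  · rw [hspan]
    ext v
    exact (hk v).symm
  · rw [hspan]
    let φ : LinearMap.ker Z.mulVecLin →ₗ[ℤ] ({i // i ∉ Set.range g} → ℤ) :=
      (LinearMap.funLeft ℤ ℤ (Subtype.val)).comp (LinearMap.ker Z.mulVecLin).subtype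
    have hφ : Function.Bijective φ := by
      constructor
      · rw [← LinearMap.ker_eq_bot, LinearMap.ker_eq_bot']
        rintro ⟨w, hw⟩ h
        apply Subtype.ext
        exact key w hw (fun i hi => congrFun h ⟨i, hi⟩)
      · intro y
        obtain ⟨w, hw, hwy⟩ := ext (Function.extend Subtype.val y 0)
        refine ⟨⟨w, hw⟩, ?_⟩
        funext i
        have := hwy i.1 i.2
        rw [Subtype.val_injective.extend_apply] at this
        exact this
    rw [(LinearEquiv.ofBijective φ hφ).finrank_eq, Module.finrank_fintype_fun_eq_card,
      Fintype.card_subtype_compl]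
    have : Fintype.card {i // i ∈ Set.range g} = r := by
      rw [← Fintype.card_congr (Equiv.ofInjective g hg)]
      simp
    rw [this, Fintype.card_fin]
end

section
/- Let A be an integer matrix with r rows and n columns of rank r, and suppose some r columns of A form the r×r identity matrix. Suppose further that for every support-minimal nonzero vector v ∈ ker(A) ∩ ℤ^n there exists a vector w ∈ ker(A) ∩ ℤ^n with the same support as v all of whose entries lie in {−1,0,1}. Then A is unimodular: every r×r submatrix of A has determinant in {−1,0,1}. -/
/-- A nonzero integer vector in the kernel of the integer matrix `A` is support-minimal if no
nonzero integer kernel vector has support properly contained in its support. -/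
def IsSupportMinimalKerVecInt {r n : ℕ} (A : Matrix (Fin r) (Fin n) ℤ) (v : Fin n → ℤ) : Prop :=
  v ≠ 0 ∧ A.mulVec v = 0 ∧
    ∀ w : Fin n → ℤ, w ≠ 0 → A.mulVec w = 0 → ¬ (Function.support w ⊂ Function.support v)

lemma mulVec_split_aux {r n : ℕ} (A : Matrix (Fin r) (Fin n) ℤ) (g : Fin r → Fin n)
    (hg : Function.Injective g) (c : Fin n) (hc : ∀ k, g k ≠ c) (u : Fin n → ℤ)
    (hu : ∀ l, l ≠ c → (∀ k, g k ≠ l) → u l = 0) (i : Fin r) :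
    A.mulVec u i = (A.submatrix id g).mulVec (u ∘ g) i + A i c * u c := by
  have hcn : c ∉ Finset.univ.image g := by simpa using hc
  have h1 : A.mulVec u i = ∑ l ∈ insert c (Finset.univ.image g), A i l * u l := by
    simp only [Matrix.mulVec, dotProduct]
    symm
    apply Finset.sum_subset (Finset.subset_univ _)
    intro l _ hl
    simp only [Finset.mem_insert, Finset.mem_image, Finset.mem_univ, true_and, not_or,
      not_exists] at hl
    rw [hu l hl.1 hl.2, mul_zero]
  rw [h1, Finset.sum_insert hcn, Finset.sum_image (fun a _ b _ h => hg h), add_comm]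
  rfl

lemma column_solve_aux {r n : ℕ} (A : Matrix (Fin r) (Fin n) ℤ)
    (hMin : ∀ v : Fin n → ℤ, IsSupportMinimalKerVecInt A v →
      ∃ w : Fin n → ℤ, A.mulVec w = 0 ∧ Function.support w = Function.support v ∧
        ∀ i : Fin n, w i ∈ ({-1, 0, 1} : Set ℤ))
    (g : Fin r → Fin n) (hd : (A.submatrix id g).det ≠ 0) (c : Fin n) :
    ∃ x : Fin r → ℤ, (A.submatrix id g).mulVec x = fun i => A i c := by
  classical
  have hg : Function.Injective g := by
    intro a b hab
    by_contra hne
    exact hd (Matrix.det_zero_of_column_eq hne (fun i => by simp [hab]))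
  by_cases hc : ∃ k, g k = c
  · obtain ⟨k, rfl⟩ := hc
    refine ⟨Pi.single k 1, ?_⟩
    ext i
    simp
  push Not at hc
  set B := A.submatrix id g with hB
  set y : Fin r → ℤ := B.adjugate.mulVec (fun i => A i c) with hy
  have hBy : B.mulVec y = B.det • (fun i => A i c) := by
    rw [hy, Matrix.mulVec_mulVec, Matrix.mul_adjugate, Matrix.smul_mulVec, Matrix.one_mulVec]
  let v : Fin n → ℤ := fun l => if h : ∃ k, g k = l then y h.choose else
    if l = c then - B.det else 0
  have hvg : v ∘ g = y := by
    ext k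
    have h : ∃ k', g k' = g k := ⟨k, rfl⟩
    simp only [v, Function.comp, dif_pos h]
    rw [hg h.choose_spec]
  have hvc : v c = - B.det := by
    have h : ¬ ∃ k, g k = c := by simpa using hc
    simp only [v, dif_neg h, if_true]
  have hv0 : ∀ l, l ≠ c → (∀ k, g k ≠ l) → v l = 0 := by
    intro l hl hk
    have h : ¬ ∃ k, g k = l := by simpa using hk
    simp only [v, dif_neg h, if_neg hl]
  have hAv : A.mulVec v = 0 := by
    ext i
    rw [mulVec_split_aux A g hg c hc v hv0, hvg, ← hB, hBy, hvc]
    simp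
    ring
  -- kernel vectors supported on the range of g vanish
  have key : ∀ u : Fin n → ℤ, A.mulVec u = 0 → (∀ l, l ≠ c → (∀ k, g k ≠ l) → u l = 0) →
      u c = 0 → u = 0 := by
    intro u hu hs huc
    have h : B.mulVec (u ∘ g) = 0 := by
      ext i
      have := mulVec_split_aux A g hg c hc u hs i
      rw [hu, huc] at this
      simpa using this.symm
    have h2 := Matrix.eq_zero_of_mulVec_eq_zero hd h
    ext l
    by_cases hl : l = c
    · rw [hl, huc]; rfl
    by_cases hk : ∃ k, g k = l
    · obtain ⟨k, rfl⟩ := hk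
      exact congrFun h2 k
    · push Not at hk
      exact hs l hl hk
  have hvcne : v c ≠ 0 := by rw [hvc]; exact neg_ne_zero.mpr hd
  have hmin : IsSupportMinimalKerVecInt A v := by
    refine ⟨fun h => hvcne (by rw [h]; rfl), hAv, ?_⟩
    intro w hw hAw hss
    have hws : ∀ l, v l = 0 → w l = 0 := by
      intro l hl
      by_contra hne
      exact hss.1 (show l ∈ Function.support w from hne) hl
    have hwc : w c ≠ 0 := fun h => hw (key w hAw (fun l h1 h2 => hws l (hv0 l h1 h2)) h)
    have hz : w c • v - v c • w = 0 := by
      apply key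
      · rw [Matrix.mulVec_sub, Matrix.mulVec_smul, Matrix.mulVec_smul, hAv, hAw]; simp
      · intro l h1 h2
        simp [hv0 l h1 h2, hws l (hv0 l h1 h2)]
      · simp [mul_comm]
    apply hss.2
    intro l hl hwl
    have := congrFun hz l
    simp [hwl, hwc] at this
    exact hl this
  obtain ⟨w, hAw, hsup, hw⟩ := hMin v hmin
  have hiff : ∀ l, w l = 0 ↔ v l = 0 := by
    intro l
    have : l ∈ Function.support w ↔ l ∈ Function.support v := by rw [hsup]
    simpa [Function.mem_support, not_iff_not] using this
  have hwc : w c ≠ 0 := fun h => hvcne ((hiff c).1 h)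
  have hwc2 : w c * w c = 1 := by
    have := hw c
    simp only [Set.mem_insert_iff, Set.mem_singleton_iff] at this
    rcases this with h | h | h
    · rw [h]; rfl
    · exact absurd h hwc
    · rw [h]; rfl
  refine ⟨(- w c) • (w ∘ g), ?_⟩
  rw [Matrix.mulVec_smul]
  ext i
  have := mulVec_split_aux A g hg c hc w (fun l h1 h2 => (hiff l).2 (hv0 l h1 h2)) i
  rw [hAw, ← hB] at this
  simp only [Pi.zero_apply] at this
  simp only [Pi.smul_apply, smul_eq_mul]
  linear_combination w c * this + A i c * hwc2

/-- Let `A` be an integer `r × n` matrix of rank `r` such that some `r` columns of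
`A` form the `r × r` identity matrix.  Suppose that for every support-minimal nonzero vector
`v ∈ ker(A) ∩ ℤ^n` there is `w ∈ ker(A) ∩ ℤ^n` with the same support as `v` and all entries in
`{-1,0,1}`.  Then `A` is unimodular: every `r × r` submatrix has determinant in `{-1,0,1}`. -/
theorem statement4 {r n : ℕ} (A : Matrix (Fin r) (Fin n) ℤ)
    (hrank : (A.map ((↑·) : ℤ → ℚ)).rank = r)
    (hId : ∃ g : Fin r → Fin n, ∀ i j : Fin r, A i (g j) = if i = j then 1 else 0)
    (hMin : ∀ v : Fin n → ℤ, IsSupportMinimalKerVecInt A v →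
      ∃ w : Fin n → ℤ, A.mulVec w = 0 ∧ Function.support w = Function.support v ∧
        ∀ i : Fin n, w i ∈ ({-1, 0, 1} : Set ℤ)) :
    ∀ g : Fin r → Fin n, (A.submatrix id g).det ∈ ({-1, 0, 1} : Set ℤ) := by
  intro g
  by_cases hd : (A.submatrix id g).det = 0
  · simp [hd]
  obtain ⟨g0, hg0⟩ := hId
  choose x hx using fun j => column_solve_aux A hMin g hd (g0 j)
  have hX : A.submatrix id g * (Matrix.of fun k j => x j k) = 1 := by
    ext i j
    have := congrFun (hx j) i
    rw [hg0] at this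
    rw [Matrix.one_apply, ← this]
    rfl
  have hdet := congrArg Matrix.det hX
  rw [Matrix.det_mul, Matrix.det_one] at hdet
  rcases Int.isUnit_iff.1 (IsUnit.of_mul_eq_one _ hdet) with h | h <;> simp [h]
end

section
/- Let A be a totally unimodular matrix over ℚ with n columns, and let v be a support-minimal nonzero element of ker(A) ∩ ℤ^n whose entries have greatest common divisor 1. Then every entry of v lies in {−1,0,1}. -/
/-- A matrix over `ℚ` with trivial kernel has an invertible square submatrix using all columns. -/
lemma exists_rows_isUnit {m : ℕ} {S : Type} [Fintype S] [DecidableEq S]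
    (M : Matrix (Fin m) S ℚ) (hM : LinearIndependent ℚ M.col) :
    ∃ f : S → Fin m, IsUnit (M.submatrix f id) := by
  obtain ⟨κ, a, ha, hspan, hli⟩ := exists_linearIndependent' ℚ M.row
  have : Finite κ := Finite.of_injective a ha
  have := Fintype.ofFinite κ
  have h1 : M.rank = Fintype.card S := by
    rw [← Matrix.rank_transpose]
    exact hM.rank_matrix
  rw [Matrix.rank_eq_finrank_span_row, ← hspan, finrank_span_eq_card hli] at h1
  let e : S ≃ κ := Fintype.equivOfCardEq h1.symm
  refine ⟨a ∘ e, ?_⟩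
  rw [← Matrix.linearIndependent_rows_iff_isUnit]
  exact hli.comp e e.injective

/-- Clearing denominators. -/
lemma exists_int_mult {n : ℕ} (c : Fin n → ℚ) :
    ∃ (b : ℚ) (w : Fin n → ℤ), b ≠ 0 ∧ ∀ i, (w i : ℚ) = b * c i := by
  obtain ⟨b, hb⟩ := IsLocalization.exist_integer_multiples_of_finite (nonZeroDivisors ℤ) c
  choose w hw using hb
  refine ⟨((b : ℤ) : ℚ), w, ?_, ?_⟩
  · exact_mod_cast nonZeroDivisors.ne_zero b.2
  · intro i
    have := hw i
    simpa using this

/-- Let `A` be a totally unimodular matrix over `ℚ` with `n` columns, and let `v`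
be a support-minimal nonzero element of `ker(A) ∩ ℤ^n` whose entries have greatest common
divisor `1`.  Then every entry of `v` lies in `{-1,0,1}`. -/
theorem statement5 {m n : ℕ} (A : Matrix (Fin m) (Fin n) ℚ)
    (hTU : A.IsTotallyUnimodular) (v : Fin n → ℤ) (hv : v ≠ 0)
    (hvker : A.mulVec (fun i => (v i : ℚ)) = 0)
    (hmin : ∀ w : Fin n → ℤ, w ≠ 0 → A.mulVec (fun i => (w i : ℚ)) = 0 →
      ¬ (Function.support w ⊂ Function.support v))
    (hgcd : Finset.univ.gcd v = 1) :
    ∀ i : Fin n, v i ∈ ({-1, 0, 1} : Set ℤ) := by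
  intro j
  by_cases hj : v j = 0
  · simp [hj]
  let S := {i : Fin n // v i ≠ 0 ∧ i ≠ j}
  let g : S → Fin n := Subtype.val
  have hext : ∀ (c : Fin n → ℚ), (∀ i, ¬ (v i ≠ 0 ∧ i ≠ j) → c i = 0) → ∀ r,
      ∑ i, A r i * c i = ∑ s : S, A r (g s) * c (g s) := by
    intro c hc r
    symm
    refine Fintype.sum_of_injective g Subtype.val_injective _ _ (fun i hi => ?_) (fun s => rfl)
    rw [hc i (fun h => hi ⟨⟨i, h⟩, rfl⟩), mul_zero]
  have hli : LinearIndependent ℚ (A.submatrix id g).col := by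
    rw [← Matrix.mulVec_injective_iff, ← Matrix.coe_mulVecLin, ← LinearMap.ker_eq_bot,
      LinearMap.ker_eq_bot']
    intro c hc
    by_contra hne
    let c' : Fin n → ℚ := fun i => if h : v i ≠ 0 ∧ i ≠ j then c ⟨i, h⟩ else 0
    obtain ⟨b, w, hb, hw⟩ := exists_int_mult c'
    have hw0 : ∀ i, ¬ (v i ≠ 0 ∧ i ≠ j) → w i = 0 := by
      intro i hi
      have := hw i
      simp only [c', dif_neg hi, mul_zero] at this
      exact_mod_cast this
    refine hmin w ?_ ?_ ?_
    · rintro rfl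
      apply hne
      funext s
      have := hw s.1
      simp only [c', dif_pos s.2] at this
      simpa [hb] using this
    · funext r
      have h1 := hext (fun i => (w i : ℚ)) (fun i hi => by simp [hw0 i hi]) r
      have h2 := congrFun hc r
      simp only [Matrix.mulVec, dotProduct, Matrix.mulVecLin_apply, Matrix.submatrix_apply, id,
        Pi.zero_apply] at h2 ⊢
      rw [h1]
      have : ∀ s : S, A r (g s) * (w (g s) : ℚ) = b * (A r (g s) * c s) := by
        intro s
        rw [hw]
        simp only [c', g, dif_pos s.2]
        ring
      simp only [this, ← Finset.mul_sum, h2, mul_zero]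
    · refine ⟨fun i hi => ?_, fun h => ?_⟩
      · by_contra h'
        exact hi (hw0 i (fun h => h' h.1))
      · exact h (show v j ≠ 0 from hj) (hw0 j (fun h => h.2 rfl))
  obtain ⟨f, hf⟩ := exists_rows_isUnit _ hli
  set B : Matrix S S ℚ := (A.submatrix id g).submatrix f id with hB
  rw [Matrix.isUnit_iff_isUnit_det, isUnit_iff_ne_zero] at hf
  have hTU' := (Matrix.isTotallyUnimodular_iff_fintype A).1 hTU S
  have hBv : B.mulVec (fun s => (v (g s) : ℚ)) = (-(v j : ℚ)) • (fun s => A (f s) j) := by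
    funext s
    have h1 := congrFun hvker (f s)
    have h2 := hext (fun i => if i = j then 0 else (v i : ℚ)) (fun i hi => by
      by_cases h : i = j
      · simp [h]
      · have : v i = 0 := by tauto
        simp [this]) (f s)
    have h3 : ∑ t : S, A (f s) (g t) * (if g t = j then 0 else (v (g t) : ℚ))
        = ∑ t : S, A (f s) (g t) * (v (g t) : ℚ) :=
      Finset.sum_congr rfl fun t _ => by rw [if_neg t.2.2]
    have h4 : ∑ i, A (f s) i * (v i : ℚ) = A (f s) j * v j +
        ∑ i, A (f s) i * (if i = j then 0 else (v i : ℚ)) := by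
      rw [← Finset.add_sum_erase _ _ (Finset.mem_univ j),
        ← Finset.add_sum_erase (a := j) _ (fun i => A (f s) i * (if i = j then 0 else (v i : ℚ)))
          (Finset.mem_univ j)]
      simp only [if_true, mul_zero, zero_add]
      congr 1
      exact Finset.sum_congr rfl fun t ht => by rw [if_neg (Finset.ne_of_mem_erase ht)]
    simp only [Matrix.mulVec, dotProduct, Pi.zero_apply] at h1
    simp only [hB, Matrix.mulVec, dotProduct, Matrix.submatrix_apply, id, Pi.smul_apply,
      smul_eq_mul]
    linarith
  have hcr : ∀ s : S, B.det * v (g s) =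
      -(v j : ℚ) * (A.submatrix f (Function.update g s j)).det := by
    intro s
    have h := congrArg (fun x => B.cramer x s) hBv
    simp only [map_smul, Pi.smul_apply, smul_eq_mul, Matrix.cramer_apply (i := s)
      (b := fun s => A (f s) j)] at h
    rw [Matrix.cramer_eq_adjugate_mulVec, Matrix.mulVec_mulVec, Matrix.adjugate_mul,
      Matrix.smul_mulVec, Matrix.one_mulVec] at h
    simp only [Pi.smul_apply, smul_eq_mul] at h
    rw [h]
    congr 2
    ext x y
    by_cases hy : y = s
    · subst hy; simp
    · simp [hy, hB]
  have hdvd : ∀ i, v j ∣ v i := by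
    intro i
    by_cases hi : v i = 0
    · simp [hi]
    by_cases hij : i = j
    · simp [hij]
    have h := hcr ⟨i, hi, hij⟩
    obtain ⟨a, ha⟩ := hTU' f g
    obtain ⟨b, hb⟩ := hTU' f (Function.update g ⟨i, hi, hij⟩ j)
    have ha' : (a : ℚ) = B.det := ha
    rw [← ha'] at h hf
    rw [← hb] at h
    change (a : ℚ) * (v i : ℚ) = _ at h
    have h' : (a : ℤ) * v i = -(v j) * (b : ℤ) := by
      have e1 : ((a : ℤ) : ℚ) = (a : ℚ) := by cases a <;> simp
      have e2 : ((b : ℤ) : ℚ) = (b : ℚ) := by cases b <;> simp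
      rw [← e1, ← e2] at h
      exact_mod_cast h
    have hd : v j ∣ (a : ℤ) * v i := ⟨-(b : ℤ), by rw [h']; ring⟩
    cases a
    · simp at hf
    · simpa using hd
    · simpa using hd
  have h1 : v j ∣ 1 := hgcd ▸ Finset.dvd_gcd fun i _ => hdvd i
  rcases Int.isUnit_iff.1 (isUnit_of_dvd_one h1) with h | h <;> simp [h]
end

section
/- Let B be a subset of {1, …, n}. For each index e ∉ B let c_e ∈ ℤ^n be a vector all of whose entries lie in {−1,0,1}, such that the e-th entry of c_e is nonzero and c_e vanishes at every index f ∉ B with f ≠ e. Let c ∈ ℤ^n be a vector all of whose entries lie in {−1,0,1} that does not belong to the ℤ-span of {c_e : e ∉ B}. Then the family {c} ∪ {c_e : e ∉ B} is linearly independent over ℚ; in particular, the subgroup of ℤ^n it generates has rank equal to |{e : e ∉ B}| + 1. -/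
/-- Let `B ⊆ {1,…,n}`.  For each `e ∉ B` let `c_e ∈ ℤ^n` have all entries in
`{-1,0,1}`, with `(c_e)_e ≠ 0` and `(c_e)_f = 0` for every `f ∉ B` with `f ≠ e`.  Let `c ∈ ℤ^n`
have all entries in `{-1,0,1}` and not lie in the `ℤ`-span of `{c_e : e ∉ B}`.  Then the family
`{c} ∪ {c_e : e ∉ B}` is linearly independent over `ℚ`; in particular the subgroup of `ℤ^n` it
generates has rank `|{e : e ∉ B}| + 1`. -/
theorem statement6 {n : ℕ} (B : Finset (Fin n))
    (cFam : {e : Fin n // e ∉ B} → (Fin n → ℤ))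
    (hcFamEntries : ∀ e, ∀ i : Fin n, cFam e i ∈ ({-1, 0, 1} : Set ℤ))
    (hcFamDiag : ∀ e, cFam e e.1 ≠ 0)
    (hcFamOff : ∀ e, ∀ f : Fin n, f ∉ B → f ≠ e.1 → cFam e f = 0)
    (c : Fin n → ℤ)
    (hcEntries : ∀ i : Fin n, c i ∈ ({-1, 0, 1} : Set ℤ))
    (hcNotSpan : c ∉ Submodule.span ℤ (Set.range cFam)) :
    LinearIndependent ℚ (fun o : Option {e : Fin n // e ∉ B} =>
      (fun i : Fin n => ((o.elim c cFam i : ℤ) : ℚ))) ∧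
    Module.finrank ℤ (Submodule.span ℤ
        (Set.range (fun o : Option {e : Fin n // e ∉ B} => o.elim c cFam))) =
      Fintype.card {e : Fin n // e ∉ B} + 1 := by
  classical
  have hsq : ∀ e, cFam e e.1 * cFam e e.1 = 1 := by
    intro e
    have h1 := hcFamEntries e e.1
    have h2 := hcFamDiag e
    simp only [Set.mem_insert_iff, Set.mem_singleton_iff] at h1
    rcases h1 with h | h | h
    · rw [h]; norm_num
    · exact absurd h h2
    · rw [h]; norm_num
  have hZ : LinearIndependent ℤ
      (fun o : Option {e : Fin n // e ∉ B} => o.elim c cFam) := by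
    rw [Fintype.linearIndependent_iff]
    intro g hg
    rw [Fintype.sum_option] at hg
    simp only [Option.elim] at hg
    have hev : ∀ f : {e : Fin n // e ∉ B},
        g none * c f.1 + g (some f) * cFam f f.1 = 0 := by
      intro f
      have h := congrFun hg f.1
      simp only [Pi.add_apply, Pi.smul_apply, Finset.sum_apply, smul_eq_mul,
        Pi.zero_apply] at h
      rw [Finset.sum_eq_single f] at h
      · exact h
      · intro b _ hb
        rw [hcFamOff b f.1 f.2 (fun h => hb (Subtype.ext h.symm)), mul_zero]
      · intro h; exact absurd (Finset.mem_univ f) h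
    have hgf : ∀ f : {e : Fin n // e ∉ B},
        g (some f) = - (g none * (c f.1 * cFam f f.1)) := by
      intro f
      linear_combination (cFam f f.1) * hev f - g (some f) * hsq f
    have h0 : g none = 0 := by
      by_contra hne
      apply hcNotSpan
      have hc : c = ∑ f, (c f.1 * cFam f f.1) • cFam f := by
        have h2 : g none • (c - ∑ f, (c f.1 * cFam f f.1) • cFam f) = 0 := by
          rw [← hg, smul_sub, Finset.smul_sum, sub_eq_add_neg, ← Finset.sum_neg_distrib]
          congr 1
          apply Finset.sum_congr rfl
          intro f _
          rw [hgf f, neg_smul, mul_smul (g none)]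
        exact sub_eq_zero.mp ((smul_eq_zero.mp h2).resolve_left hne)
      rw [hc]
      exact Submodule.sum_mem _ fun f _ =>
        Submodule.smul_mem _ _ (Submodule.subset_span ⟨f, rfl⟩)
    intro o
    cases o with
    | none => exact h0
    | some f => rw [hgf f, h0]; simp
  refine ⟨?_, ?_⟩
  · rw [← LinearIndependent.iff_fractionRing ℤ ℚ]
    have hinj : Function.Injective
        ((Int.castAddHom ℚ).toIntLinearMap.compLeft (Fin n)) := by
      intro x y h
      funext i
      have := congrFun h i
      simpa using this
    exact hZ.map' _ (LinearMap.ker_eq_bot.mpr hinj)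
  · rw [finrank_span_eq_card hZ, Fintype.card_option]
end

section
/- Let A be an integer matrix with r rows and n columns of rank r such that every r×r submatrix of A has determinant in {−1,0,1} (A is unimodular). Let Λ = ker(A) ∩ ℤ^n be the lattice of integer vectors annihilated by A, and let Λ* ⊆ ℤ^n be the subgroup generated by the rows of A. Then Λ ∩ Λ* = {0}, the quotient group ℤ^n/(Λ + Λ*) is finite, and its cardinality equals the number of r-element subsets S of the column indices for which the r×r submatrix of A on the columns S is invertible (i.e., the number of bases of the matroid represented by A). -/
namespace St7
open Matrix Finset

lemma detPerm {r n : ℕ} (A : Matrix (Fin r) (Fin n) ℤ) (g : Fin r → Fin n)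
    (σ : Equiv.Perm (Fin r)) :
    (A.submatrix id (g ∘ σ)).det = (Equiv.Perm.sign σ : ℤ) * (A.submatrix id g).det := by
  have := Matrix.det_permute' σ (A.submatrix id g)
  simpa using this

lemma gram_expand {r n : ℕ} (A : Matrix (Fin r) (Fin n) ℤ) :
    (A * Aᵀ).det = ∑ g : Fin r → Fin n, (∏ i, A i (g i)) * (A.submatrix id g).det := by
  have h : (A * Aᵀ) = Matrix.of (fun i => ∑ k : Fin n, A i k • (fun j => A j k)) := by
    ext i j
    simp [Matrix.mul_apply, Finset.sum_apply]
  rw [h]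
  have := (Matrix.detRowAlternating (R := ℤ) (n := Fin r)).toMultilinearMap.map_sum
    (fun i (k : Fin n) => A i k • (fun j => A j k))
  refine this.trans ?_
  refine Finset.sum_congr rfl fun g _ => ?_
  refine ((Matrix.detRowAlternating (R := ℤ) (n := Fin r)).toMultilinearMap.map_smul_univ
    (fun i => A i (g i)) (fun i j => A j (g i))).trans ?_
  rw [smul_eq_mul]
  congr 1
  exact Matrix.det_transpose (A.submatrix id g)

lemma gram_sq {r n : ℕ} (A : Matrix (Fin r) (Fin n) ℤ) :
    (r.factorial : ℤ) * (A * Aᵀ).det = ∑ g : Fin r → Fin n, (A.submatrix id g).det ^ 2 := by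
  have h1 : ∀ σ : Equiv.Perm (Fin r), (A * Aᵀ).det = ∑ g : Fin r → Fin n,
      (∏ i, A i (g (σ i))) * ((Equiv.Perm.sign σ : ℤ) * (A.submatrix id g).det) := by
    intro σ
    rw [gram_expand]
    rw [← Equiv.sum_comp (Equiv.arrowCongr σ.symm (Equiv.refl (Fin n)))]
    refine Finset.sum_congr rfl fun g _ => ?_
    rw [← detPerm]
    rfl
  have h2 : (r.factorial : ℤ) * (A * Aᵀ).det = ∑ σ : Equiv.Perm (Fin r), (A * Aᵀ).det := by
    simp [Fintype.card_perm]
  rw [h2, Finset.sum_congr rfl fun σ _ => h1 σ, Finset.sum_comm]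
  refine Finset.sum_congr rfl fun g _ => ?_
  have h3 : (A.submatrix id g).det =
      ∑ σ : Equiv.Perm (Fin r), (Equiv.Perm.sign σ : ℤ) * ∏ i, A i (g (σ i)) := by
    rw [← Matrix.det_transpose, Matrix.det_apply']
    rfl
  rw [pow_two]
  conv_rhs => lhs; rw [h3]
  rw [Finset.sum_mul]
  exact Finset.sum_congr rfl fun σ _ => by ring

lemma inj_of_det {r n : ℕ} (A : Matrix (Fin r) (Fin n) ℤ) (g : Fin r → Fin n)
    (h : (A.submatrix id g).det ≠ 0) : Function.Injective g := by
  intro i j hij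
  by_contra hne
  exact h (Matrix.det_zero_of_column_eq hne (fun k => by simp [hij]))

lemma count {r n : ℕ} (A : Matrix (Fin r) (Fin n) ℤ) :
    (univ.filter fun g : Fin r → Fin n => (A.submatrix id g).det ≠ 0).card =
      r.factorial * Nat.card {S : Finset (Fin n) // S.card = r ∧
        ∃ g : Fin r → Fin n, Function.Injective g ∧ (∀ j : Fin r, g j ∈ S) ∧
          (A.submatrix id g).det ≠ 0} := by
  classical
  rw [Nat.card_eq_fintype_card, Fintype.card_subtype, mul_comm]
  have himg : ∀ (g : Fin r → Fin n) (S : Finset (Fin n)), Function.Injective g → S.card = r →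
      (∀ j, g j ∈ S) → univ.image g = S := by
    intro g S hg hS hm
    apply Finset.eq_of_subset_of_card_le
    · intro x hx
      obtain ⟨j, -, rfl⟩ := Finset.mem_image.1 hx
      exact hm j
    · rw [Finset.card_image_of_injective _ hg, hS]; simp
  rw [Finset.card_eq_sum_card_fiberwise (f := fun g : Fin r → Fin n => univ.image g)
    (t := univ.filter fun S : Finset (Fin n) => S.card = r ∧
        ∃ g : Fin r → Fin n, Function.Injective g ∧ (∀ j : Fin r, g j ∈ S) ∧
          (A.submatrix id g).det ≠ 0)]
  · apply Finset.sum_const_nat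
    intro S hS
    obtain ⟨hS, g0, hg0, hm, hd⟩ := (Finset.mem_filter.1 hS).2
    have hi0 := himg g0 S hg0 hS hm
    have : ((univ.filter fun g : Fin r → Fin n => (A.submatrix id g).det ≠ 0).filter
        fun g => univ.image g = S) =
        (univ : Finset (Equiv.Perm (Fin r))).image (fun σ : Equiv.Perm (Fin r) => g0 ∘ ⇑σ) := by
      ext g
      simp only [Finset.mem_filter, Finset.mem_univ, true_and, Finset.mem_image]
      constructor
      · rintro ⟨hgd, hgi⟩
        have hex : ∀ j, ∃ i, g0 i = g j := by
          intro j
          have : g j ∈ univ.image g0 := by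
            rw [hi0, ← hgi]; exact Finset.mem_image_of_mem _ (Finset.mem_univ _)
          obtain ⟨i, -, hi⟩ := Finset.mem_image.1 this
          exact ⟨i, hi⟩
        choose s hs using hex
        have hsi : Function.Injective s := by
          intro a b hab
          apply inj_of_det A g hgd
          rw [← hs, ← hs, hab]
        refine ⟨Equiv.ofBijective s (Finite.injective_iff_bijective.1 hsi), ?_⟩
        funext j
        exact hs j
      · rintro ⟨σ, rfl⟩
        refine ⟨?_, himg _ _ (hg0.comp σ.injective) hS (fun j => hm _)⟩
        rw [detPerm]
        exact mul_ne_zero (by simp) hd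
    rw [this, Finset.card_image_of_injective, Finset.card_univ, Fintype.card_perm,
      Fintype.card_fin]
    intro σ τ h
    ext j
    exact congrArg Fin.val (hg0 (congrFun h j))
  · intro g hg
    have hd : (A.submatrix id g).det ≠ 0 := by simpa using hg
    have hi := inj_of_det A g hd
    simp only [Finset.coe_filter, Set.mem_ofPred_eq, Finset.mem_univ, true_and]
    refine ⟨by rw [Finset.card_image_of_injective _ hi]; simp, g, hi, fun j => ?_, hd⟩
    exact Finset.mem_image_of_mem _ (Finset.mem_univ _)

lemma card_quot {r : ℕ} (M : Matrix (Fin r) (Fin r) ℤ) (hM : M.det ≠ 0) :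
    Nat.card ((Fin r → ℤ) ⧸ LinearMap.range M.mulVecLin) = M.det.natAbs := by
  have hinj : Function.Injective M.mulVecLin := by
    rw [← LinearMap.ker_eq_bot, LinearMap.ker_eq_bot']
    intro v hv
    exact Matrix.eq_zero_of_mulVec_eq_zero hM hv
  have := Submodule.natAbs_det_equiv (LinearMap.range M.mulVecLin)
    (LinearEquiv.ofInjective M.mulVecLin hinj)
  rw [← this, ← LinearMap.det_toLin' M]
  rfl

lemma card_aux {V W : Type*} [AddCommGroup V] [AddCommGroup W] (f : V →ₗ[ℤ] W)
    (hf : Function.Surjective f) (N : Submodule ℤ W) (K : Submodule ℤ V)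
    (hK : K = LinearMap.ker (N.mkQ ∘ₗ f)) : Nat.card (V ⧸ K) = Nat.card (W ⧸ N) := by
  subst hK
  exact Nat.card_congr (LinearMap.quotKerEquivOfSurjective (N.mkQ ∘ₗ f)
    ((Submodule.mkQ_surjective N).comp hf)).toEquiv

end St7

/-- Let `A` be an integer `r × n` matrix of rank `r` that is unimodular (every
`r × r` submatrix has determinant in `{-1,0,1}`).  Let `Λ = ker(A) ∩ ℤ^n` and let `Λ*` be the
subgroup of `ℤ^n` generated by the rows of `A`.  Then `Λ ∩ Λ* = {0}`, the quotient
`ℤ^n/(Λ + Λ*)` is finite, and its cardinality equals the number of `r`-element sets `S` of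
column indices for which the `r × r` submatrix of `A` on the columns in `S` is invertible. -/
theorem statement7 {r n : ℕ} (A : Matrix (Fin r) (Fin n) ℤ)
    (hrank : (A.map ((↑·) : ℤ → ℚ)).rank = r)
    (hUni : ∀ g : Fin r → Fin n, (A.submatrix id g).det ∈ ({-1, 0, 1} : Set ℤ)) :
    (LinearMap.ker A.mulVecLin ⊓ Submodule.span ℤ (Set.range (fun i : Fin r => A i)) = ⊥) ∧
    Finite ((Fin n → ℤ) ⧸
      (LinearMap.ker A.mulVecLin ⊔ Submodule.span ℤ (Set.range (fun i : Fin r => A i)))) ∧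
    Nat.card ((Fin n → ℤ) ⧸
        (LinearMap.ker A.mulVecLin ⊔ Submodule.span ℤ (Set.range (fun i : Fin r => A i)))) =
      Nat.card {S : Finset (Fin n) // S.card = r ∧
        ∃ g : Fin r → Fin n, Function.Injective g ∧ (∀ j : Fin r, g j ∈ S) ∧
          (A.submatrix id g).det ≠ 0} := by
  classical
  have hdet : (A * A.transpose).det ≠ 0 := by
    intro h0
    have h1 : ((A.map ((↑·) : ℤ → ℚ)) * (A.map ((↑·) : ℤ → ℚ)).transpose).det = 0 := by
      have : (A.map ((↑·) : ℤ → ℚ)) * (A.map ((↑·) : ℤ → ℚ)).transpose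
          = (Int.castRingHom ℚ).mapMatrix (A * A.transpose) := by
        ext i j
        simp [Matrix.mul_apply]
      rw [this, ← RingHom.map_det, h0, map_zero]
    have h2 := Matrix.rank_self_mul_transpose (A.map ((↑·) : ℤ → ℚ))
    rw [hrank] at h2
    obtain ⟨v, hv0, hv⟩ := Matrix.exists_mulVec_eq_zero_iff.2 h1
    have h3 := LinearMap.finrank_range_add_finrank_ker
      ((A.map ((↑·) : ℤ → ℚ)) * (A.map ((↑·) : ℤ → ℚ)).transpose).mulVecLin
    rw [← Matrix.rank, h2, Module.finrank_fin_fun] at h3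
    have h4 := Submodule.finrank_eq_zero.1 (Nat.add_eq_left.1 h3)
    exact hv0 (LinearMap.ker_eq_bot'.1 h4 v hv)
  have hcount : (A * A.transpose).det = (Nat.card {S : Finset (Fin n) // S.card = r ∧
        ∃ g : Fin r → Fin n, Function.Injective g ∧ (∀ j : Fin r, g j ∈ S) ∧
          (A.submatrix id g).det ≠ 0} : ℕ) := by
    have h1 := St7.gram_sq A
    have h2 : ∑ g : Fin r → Fin n, (A.submatrix id g).det ^ 2 =
        ((Finset.univ.filter fun g : Fin r → Fin n => (A.submatrix id g).det ≠ 0).card : ℤ) := by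
      rw [Finset.card_filter, Nat.cast_sum]
      refine Finset.sum_congr rfl fun g _ => ?_
      have h := hUni g
      simp only [Set.mem_insert_iff, Set.mem_singleton_iff] at h
      rcases h with h | h | h <;> simp [h]
    rw [h2, St7.count, Nat.cast_mul] at h1
    exact mul_left_cancel₀ (by exact_mod_cast Nat.factorial_ne_zero r) h1
  have hsurj : Function.Surjective A.mulVecLin := by
    have : ∃ g : Fin r → Fin n, (A.submatrix id g).det ≠ 0 := by
      by_contra! hno
      apply hdet
      have h1 := St7.gram_sq A
      simp only [hno] at h1
      have h2 : (r.factorial : ℤ) ≠ 0 := by exact_mod_cast Nat.factorial_ne_zero r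
      rw [Finset.sum_eq_zero (fun g _ => by simp)] at h1
      exact (mul_eq_zero.1 h1).resolve_left h2
    obtain ⟨g, hg⟩ := this
    have hu : IsUnit (A.submatrix id g).det := by
      have h := hUni g
      simp only [Set.mem_insert_iff, Set.mem_singleton_iff] at h
      rcases h with h | h | h
      · rw [h]; exact isUnit_one.neg
      · exact absurd h hg
      · rw [h]; exact isUnit_one
    have hP : A.submatrix id g = A * (1 : Matrix (Fin n) (Fin n) ℤ).submatrix id g := by
      ext i j
      simp [Matrix.mul_apply, Matrix.one_apply]
    intro v
    refine ⟨((1 : Matrix (Fin n) (Fin n) ℤ).submatrix id g).mulVec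
      ((A.submatrix id g)⁻¹.mulVec v), ?_⟩
    rw [Matrix.mulVecLin_apply, Matrix.mulVec_mulVec, ← hP, Matrix.mulVec_mulVec,
      Matrix.mul_nonsing_inv _ hu, Matrix.one_mulVec]
  have hspan : Submodule.span ℤ (Set.range (fun i : Fin r => A i)) =
      LinearMap.range (A.transpose).mulVecLin := by
    rw [Matrix.range_mulVecLin]; rfl
  have hmap : Submodule.map A.mulVecLin (LinearMap.range (A.transpose).mulVecLin) =
      LinearMap.range (A * A.transpose).mulVecLin := by
    rw [Matrix.mulVecLin_mul, LinearMap.range_comp]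
  have hcard : Nat.card ((Fin n → ℤ) ⧸
      (LinearMap.ker A.mulVecLin ⊔ Submodule.span ℤ (Set.range (fun i : Fin r => A i)))) =
      (A * A.transpose).det.natAbs := by
    rw [← St7.card_quot _ hdet]
    have hk : LinearMap.ker A.mulVecLin ⊔ Submodule.span ℤ (Set.range (fun i : Fin r => A i)) =
        LinearMap.ker ((LinearMap.range (A * A.transpose).mulVecLin).mkQ ∘ₗ A.mulVecLin) := by
      rw [LinearMap.ker_comp, Submodule.ker_mkQ, ← hmap, Submodule.comap_map_eq, hspan, sup_comm]
    exact St7.card_aux _ hsurj _ _ hk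
  refine ⟨?_, ?_, ?_⟩
  · rw [eq_bot_iff, hspan]
    rintro v ⟨hv, c, rfl⟩
    have hv' : (A * A.transpose).mulVec c = 0 := by
      rw [← Matrix.mulVec_mulVec]; exact hv
    rw [Matrix.eq_zero_of_mulVec_eq_zero hdet hv']
    simp
  · apply Nat.finite_of_card_ne_zero
    rw [hcard]
    exact Int.natAbs_ne_zero.2 hdet
  · rw [hcard, hcount, Int.natAbs_natCast]
end

section
/- Let A be an integer matrix with r rows and n columns of rank r such that every r×r submatrix of A has determinant in {−1,0,1} (A is unimodular). Let Λ = ker(A) ∩ ℤ^n, let Λ* ⊆ ℤ^n be the subgroup generated by the rows of A, and let Λ^# = {y ∈ ℚ^n : A·y = 0 and ⟨x, y⟩ ∈ ℤ for all x ∈ Λ} be the dual lattice of Λ inside the rational kernel of A. Then there is an isomorphism of abelian groups ℤ^n/(Λ + Λ*) ≅ Λ^#/Λ. -/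
/-- Coordinatewise coercion `ℤ^n → ℚ^n` as a `ℤ`-linear map. -/
def intCoePi (n : ℕ) : (Fin n → ℤ) →ₗ[ℤ] (Fin n → ℚ) where
  toFun v := fun i => (v i : ℚ)
  map_add' u v := by funext i; simp
  map_smul' c v := by funext i; simp

/-- The lattice `Λ = ker(A) ∩ ℤ^n` of integer vectors annihilated by `A`. -/
def kerLat {r n : ℕ} (A : Matrix (Fin r) (Fin n) ℤ) : Submodule ℤ (Fin n → ℤ) :=
  LinearMap.ker A.mulVecLin

/-- The dual lattice `Λ^# = {y ∈ ℚ^n : A·y = 0 and ⟨x,y⟩ ∈ ℤ for all x ∈ Λ}` of `Λ = kerLat A`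
inside the rational kernel of `A`. -/
def dualLat {r n : ℕ} (A : Matrix (Fin r) (Fin n) ℤ) : Submodule ℤ (Fin n → ℚ) where
  carrier := {y : Fin n → ℚ | (A.map ((↑·) : ℤ → ℚ)).mulVec y = 0 ∧
    ∀ x ∈ kerLat A, ∃ m : ℤ, ∑ i, (x i : ℚ) * y i = (m : ℚ)}
  zero_mem' := by
    refine ⟨Matrix.mulVec_zero _, fun x _ => ⟨0, by simp⟩⟩
  add_mem' := by
    rintro a b ⟨ha0, ha⟩ ⟨hb0, hb⟩
    refine ⟨by rw [Matrix.mulVec_add, ha0, hb0, add_zero], fun x hx => ?_⟩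
    obtain ⟨ma, hma⟩ := ha x hx
    obtain ⟨mb, hmb⟩ := hb x hx
    refine ⟨ma + mb, ?_⟩
    simp only [Pi.add_apply, mul_add, Finset.sum_add_distrib, hma, hmb]
    push_cast
    ring
  smul_mem' := by
    rintro c y ⟨hy0, hy⟩
    refine ⟨by rw [Matrix.mulVec_smul, hy0, smul_zero], fun x hx => ?_⟩
    obtain ⟨m, hm⟩ := hy x hx
    refine ⟨c * m, ?_⟩
    have : ∑ i, (x i : ℚ) * (c • y) i = (c : ℚ) * ∑ i, (x i : ℚ) * y i := by
      rw [Finset.mul_sum]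
      refine Finset.sum_congr rfl fun i _ => ?_
      simp [Pi.smul_apply, zsmul_eq_mul]
      ring
    rw [this, hm]
    push_cast
    ring

open Matrix in
theorem aux_isUnit {r : ℕ} (M : Matrix (Fin r) (Fin r) ℚ) (h : M.rank = r) : IsUnit M := by
  rw [← Matrix.linearIndependent_cols_iff_isUnit, linearIndependent_iff_card_eq_finrank_span]
  rw [Matrix.rank_eq_finrank_span_cols] at h
  simp only [Fintype.card_fin, Set.finrank]
  exact h.symm

open Matrix in
theorem aux_rightInv {r n : ℕ} (A : Matrix (Fin r) (Fin n) ℤ)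
    (hrank : (A.map ((↑·) : ℤ → ℚ)).rank = r)
    (hUni : ∀ g : Fin r → Fin n, (A.submatrix id g).det ∈ ({-1, 0, 1} : Set ℤ)) :
    ∃ B : Matrix (Fin n) (Fin r) ℤ, A * B = 1 := by
  obtain ⟨f, hf, -, hli⟩ := Submodule.exists_fun_fin_finrank_span_eq ℚ
    (Set.range (A.map ((↑·) : ℤ → ℚ)).col)
  have hr : Module.finrank ℚ (Submodule.span ℚ (Set.range (A.map ((↑·) : ℤ → ℚ)).col)) = r := by
    rw [← Matrix.rank_eq_finrank_span_cols]; exact hrank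
  obtain ⟨f, hf, hli⟩ : ∃ f : Fin r → Fin r → ℚ,
      (∀ i, f i ∈ Set.range (A.map ((↑·) : ℤ → ℚ)).col) ∧ LinearIndependent ℚ f :=
    ⟨f ∘ Fin.cast hr.symm, fun i => hf _, hli.comp _ (Fin.cast_injective _)⟩
  choose g hg using hf
  have hu : IsUnit ((A.submatrix id g).map (Int.castRingHom ℚ)) := by
    rw [← Matrix.linearIndependent_cols_iff_isUnit]
    have hfe : ((A.submatrix id g).map (Int.castRingHom ℚ)).col = f := by
      funext j
      rw [← hg j]
      rfl
    rw [hfe]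
    exact hli
  have hd : (A.submatrix id g).det ≠ 0 := by
    intro h0
    rw [Matrix.isUnit_iff_isUnit_det] at hu
    have := hu.ne_zero
    apply this
    rw [← RingHom.mapMatrix_apply, ← RingHom.map_det, h0, map_zero]
  have hdu : IsUnit (A.submatrix id g).det := by
    rcases hUni g with h | h | h
    · rw [h]; decide
    · exact absurd h hd
    · rw [Set.mem_singleton_iff.1 h]; exact isUnit_one
  refine ⟨(1 : Matrix (Fin n) (Fin n) ℤ).submatrix id g * (A.submatrix id g)⁻¹, ?_⟩
  rw [← Matrix.mul_assoc]
  have : A * (1 : Matrix (Fin n) (Fin n) ℤ).submatrix id g = A.submatrix id g := by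
    ext i j
    simp [Matrix.mul_apply, Matrix.one_apply]
  rw [this, Matrix.mul_nonsing_inv _ hdu]

open Matrix in
theorem aux_proj {r n : ℕ} (M : Matrix (Fin r) (Fin n) ℚ) (h : M.rank = r) :
    ∃ P : Matrix (Fin n) (Fin n) ℚ, (∀ x, M *ᵥ (P *ᵥ x) = 0) ∧
      (∀ x, ∃ c, x - P *ᵥ x = c ᵥ* M) ∧ (∀ c, P *ᵥ (c ᵥ* M) = 0) ∧
      (∀ y, M *ᵥ y = 0 → P *ᵥ y = y) := by
  have hu : IsUnit (M * Mᵀ) := aux_isUnit _ (by rw [Matrix.rank_self_mul_transpose, h])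
  have hd := (Matrix.isUnit_iff_isUnit_det _).1 hu
  have e (x) : (1 - Mᵀ * (M * Mᵀ)⁻¹ * M) *ᵥ x = x - Mᵀ *ᵥ ((M * Mᵀ)⁻¹ *ᵥ (M *ᵥ x)) := by
    rw [Matrix.sub_mulVec, Matrix.one_mulVec, ← Matrix.mulVec_mulVec, ← Matrix.mulVec_mulVec]
  refine ⟨1 - Mᵀ * (M * Mᵀ)⁻¹ * M, fun x => ?_, fun x => ?_, fun c => ?_, fun y hy => ?_⟩
  · rw [e, Matrix.mulVec_sub, Matrix.mulVec_mulVec _ M, Matrix.mulVec_mulVec,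
      Matrix.mul_nonsing_inv _ hd, Matrix.one_mulVec, sub_self]
  · refine ⟨(M * Mᵀ)⁻¹ *ᵥ (M *ᵥ x), ?_⟩
    rw [e, sub_sub_cancel, Matrix.mulVec_transpose]
  · rw [e, ← Matrix.mulVec_transpose, Matrix.mulVec_mulVec _ M, Matrix.mulVec_mulVec c,
      Matrix.nonsing_inv_mul _ hd, Matrix.one_mulVec, sub_self]
  · rw [e, hy, Matrix.mulVec_zero, Matrix.mulVec_zero, sub_zero]

theorem aux_castMulVec {k l : ℕ} (A : Matrix (Fin k) (Fin l) ℤ) (x : Fin l → ℤ) :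
    (A.map ((↑·) : ℤ → ℚ)).mulVec (intCoePi l x) = intCoePi k (A.mulVec x) := by
  funext i
  simp [Matrix.mulVec, dotProduct, intCoePi]

theorem aux_castVecMul {k l : ℕ} (A : Matrix (Fin k) (Fin l) ℤ) (x : Fin k → ℤ) :
    Matrix.vecMul (intCoePi k x) (A.map ((↑·) : ℤ → ℚ)) = intCoePi l (Matrix.vecMul x A) := by
  funext i
  simp [Matrix.vecMul, dotProduct, intCoePi]

theorem aux_inj (n : ℕ) : Function.Injective (intCoePi n) := by
  intro x y h
  funext i
  have := congrFun h i
  simpa [intCoePi] using this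

theorem aux_span {r n : ℕ} (A : Matrix (Fin r) (Fin n) ℤ) (x : Fin n → ℤ) :
    x ∈ Submodule.span ℤ (Set.range (fun i : Fin r => A i)) ↔
      ∃ c : Fin r → ℤ, Matrix.vecMul c A = x := by
  rw [Submodule.mem_span_range_iff_exists_fun]
  refine exists_congr fun c => ?_
  rw [Matrix.vecMul_eq_sum]

/-- Let `A` be an integer `r × n` matrix of rank `r` that is unimodular (every
`r × r` submatrix has determinant in `{-1,0,1}`).  With `Λ = ker(A) ∩ ℤ^n`, `Λ*` the subgroup
generated by the rows of `A`, and `Λ^#` the dual lattice of `Λ` inside the rational kernel of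
`A`, there is an isomorphism of abelian groups `ℤ^n/(Λ + Λ*) ≅ Λ^#/Λ`. -/
theorem statement8 {r n : ℕ} (A : Matrix (Fin r) (Fin n) ℤ)
    (hrank : (A.map ((↑·) : ℤ → ℚ)).rank = r)
    (hUni : ∀ g : Fin r → Fin n, (A.submatrix id g).det ∈ ({-1, 0, 1} : Set ℤ)) :
    Nonempty (((Fin n → ℤ) ⧸
        (kerLat A ⊔ Submodule.span ℤ (Set.range (fun i : Fin r => A i)))) ≃+
      ((dualLat A) ⧸
        (Submodule.comap (dualLat A).subtype ((kerLat A).map (intCoePi n))))) := by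
  obtain ⟨B, hB⟩ := aux_rightInv A hrank hUni
  obtain ⟨P, hP1, hP2, hP3, hP4⟩ := aux_proj _ hrank
  set M : Matrix (Fin r) (Fin n) ℚ := A.map ((↑·) : ℤ → ℚ) with hM
  have hker : ∀ x, x ∈ kerLat A ↔ M.mulVec (intCoePi n x) = 0 := by
    intro x
    rw [hM, aux_castMulVec, ← map_zero (intCoePi r), (aux_inj r).eq_iff]
    simp [kerLat]
  have hBM : M * B.map ((↑·) : ℤ → ℚ) = 1 := by
    have := congrArg (fun X => (Int.castRingHom ℚ).mapMatrix X) hB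
    simp only [map_one, RingHom.mapMatrix_apply, Matrix.map_mul] at this
    exact this
  -- orthogonality
  have horth : ∀ x ∈ kerLat A, ∀ c : Fin r → ℚ, intCoePi n x ⬝ᵥ Matrix.vecMul c M = 0 := by
    intro x hx c
    rw [dotProduct_comm, ← Matrix.dotProduct_mulVec, (hker x).1 hx, dotProduct_zero]
  have hmem : ∀ x : Fin n → ℤ, P.mulVec (intCoePi n x) ∈ dualLat A := by
    intro x
    refine ⟨hP1 _, fun z hz => ⟨z ⬝ᵥ x, ?_⟩⟩
    obtain ⟨c, hc⟩ := hP2 (intCoePi n x)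
    have h1 : P.mulVec (intCoePi n x) = intCoePi n x - Matrix.vecMul c M := by
      rw [← hc, sub_sub_cancel]
    have h2 : intCoePi n z ⬝ᵥ P.mulVec (intCoePi n x) = intCoePi n z ⬝ᵥ intCoePi n x := by
      rw [h1, dotProduct_sub, horth z hz, sub_zero]
    refine h2.trans ?_
    simp [dotProduct, intCoePi]
  let φ : (Fin n → ℤ) →ₗ[ℤ] dualLat A :=
    { toFun := fun x => ⟨P.mulVec (intCoePi n x), hmem x⟩
      map_add' := fun x y => by
        apply Subtype.ext
        simp [Matrix.mulVec_add]
      map_smul' := fun a x => by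
        apply Subtype.ext
        change P.mulVec (intCoePi n (a • x)) = a • P.mulVec (intCoePi n x)
        rw [map_smul, Matrix.mulVec_smul] }
  have hφ : Function.Surjective φ := by
    rintro ⟨y, hy0, hy⟩
    have hcol : ∀ i, (fun j => (1 - B * A : Matrix (Fin n) (Fin n) ℤ) j i) ∈ kerLat A := by
      intro i
      have h0 : A * (1 - B * A) = 0 := by
        rw [Matrix.mul_sub, Matrix.mul_one, ← Matrix.mul_assoc, hB, Matrix.one_mul, sub_self]
      change A.mulVecLin _ = 0
      funext k
      exact congrFun (congrFun h0 k) i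
    choose x hx using fun i => hy _ (hcol i)
    refine ⟨x, Subtype.ext ?_⟩
    change P.mulVec (intCoePi n x) = y
    have hxe : intCoePi n x = y - Matrix.vecMul (Matrix.vecMul y (B.map ((↑·) : ℤ → ℚ))) M := by
      have : intCoePi n x = Matrix.vecMul y (1 - B.map ((↑·) : ℤ → ℚ) * M) := by
        funext i
        change (x i : ℚ) = _
        rw [← hx i]
        simp only [Matrix.vecMul, dotProduct]
        refine Finset.sum_congr rfl fun j _ => ?_
        rw [mul_comm]
        congr 1
        simp [Matrix.sub_apply, Matrix.mul_apply, hM, Matrix.one_apply]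
      rw [this, Matrix.vecMul_sub, Matrix.vecMul_one, Matrix.vecMul_vecMul]
    rw [hxe, Matrix.mulVec_sub, hP3, sub_zero, hP4 y hy0]
  set N := Submodule.comap (dualLat A).subtype ((kerLat A).map (intCoePi n)) with hN
  have hsurj : Function.Surjective (N.mkQ ∘ₗ φ) := by
    rw [LinearMap.coe_comp]
    exact (Submodule.mkQ_surjective N).comp hφ
  have hk : LinearMap.ker (N.mkQ ∘ₗ φ) =
      kerLat A ⊔ Submodule.span ℤ (Set.range (fun i : Fin r => A i)) := by
    ext x
    rw [LinearMap.ker_comp, Submodule.ker_mkQ, Submodule.mem_comap, hN, Submodule.mem_comap,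
      Submodule.mem_map, Submodule.mem_sup]
    change (∃ z, z ∈ kerLat A ∧ intCoePi n z = P.mulVec (intCoePi n x)) ↔ _
    constructor
    · rintro ⟨z, hz, hzx⟩
      refine ⟨z, hz, x - z, ?_, by abel⟩
      rw [aux_span]
      obtain ⟨c, hc⟩ := hP2 (intCoePi n x)
      rw [← hzx, ← map_sub] at hc
      refine ⟨Matrix.vecMul (x - z) B, aux_inj n ?_⟩
      rw [← aux_castVecMul, ← aux_castVecMul, hc, Matrix.vecMul_vecMul _ M, hBM, Matrix.vecMul_one]
    · rintro ⟨z, hz, w, hw, rfl⟩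
      obtain ⟨c, rfl⟩ := (aux_span A w).1 hw
      refine ⟨z, hz, ?_⟩
      rw [map_add, ← aux_castVecMul, Matrix.mulVec_add, hP3, add_zero, hP4 _ ((hker z).1 hz)]
  exact ⟨((Submodule.quotEquivOfEq _ _ hk.symm).trans
    (LinearMap.quotKerEquivOfSurjective _ hsurj)).toAddEquiv⟩
end

section
/- Let A be a totally unimodular real matrix with r rows and n columns whose rank equals r. Then the subgroup Λσ(A) of ℤ^n generated by the sign vectors of all support-minimal nonzero kernel vectors of A has rank exactly n − r; that is, the irregularity parameter satisfies ρ(A) = 0. -/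
/-- The sign of a real number, as an integer in `{-1,0,1}`. -/
noncomputable def sgn (x : ℝ) : ℤ := if 0 < x then 1 else if x < 0 then -1 else 0

/-- A nonzero real vector in the kernel of `A` is support-minimal if no nonzero kernel vector
of `A` has support properly contained in its support. -/
def IsSupportMinimalKer {m n : Type*} [Fintype m] [Fintype n]
    (A : Matrix m n ℝ) (v : n → ℝ) : Prop :=
  v ≠ 0 ∧ A.mulVec v = 0 ∧
    ∀ w : n → ℝ, w ≠ 0 → A.mulVec w = 0 → ¬ (Function.support w ⊂ Function.support v)

/-- The circuit lattice `Λσ(A)` of the oriented matroid represented by `A`: the subgroup of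
`ℤ^n` generated by the sign vectors of all support-minimal nonzero kernel vectors of `A`. -/
noncomputable def circLat {m n : Type*} [Fintype m] [Fintype n] (A : Matrix m n ℝ) :
    Submodule ℤ (n → ℤ) :=
  Submodule.span ℤ {c : n → ℤ | ∃ v : n → ℝ, IsSupportMinimalKer A v ∧ c = fun i => sgn (v i)}

open Matrix in
theorem aux_abs {r n : ℕ} (A : Matrix (Fin r) (Fin n) ℝ)
    (hTU : A.IsTotallyUnimodular) (hrank : A.rank = r) (v : Fin n → ℝ)
    (hv : IsSupportMinimalKer A v) (j0 j : Fin n) (h0 : v j0 ≠ 0) (hj : v j ≠ 0) :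
    |v j| = |v j0| := by
  classical
  by_cases hjj : j = j0
  · rw [hjj]
  obtain ⟨hv0, hAv, hmin⟩ := hv
  have hind : LinearIndepOn ℝ A.col (Function.support v \ {j0}) := by
    rw [linearIndepOn_iff]
    intro l hl hl0
    by_contra hne
    refine hmin (fun i => l i) ?_ ?_ ?_
    · intro h
      apply hne
      ext i
      exact congrFun h i
    · rw [Finsupp.linearCombination_apply, Finsupp.sum_fintype _ _ (by simp)] at hl0
      rw [← hl0]
      ext i
      simp [Matrix.mulVec, dotProduct, Finset.sum_apply, mul_comm]
    · rw [Finsupp.mem_supported] at hl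
      have h2 : Function.support (fun i => l i) ⊆ Function.support v \ {j0} := by
        intro i hi
        exact hl (by simpa using hi)
      refine ⟨fun i hi => (h2 hi).1, fun h => ?_⟩
      exact (h2 (h h0)).2 rfl
  obtain ⟨B, -, hSB, hspan, hB⟩ := exists_linearIndepOn_extension hind (Set.subset_univ _)
  have hcard : Fintype.card B = r := by
    have h1 := finrank_span_eq_card hB
    refine h1.symm.trans (Eq.trans ?_ hrank)
    rw [rank_eq_finrank_span_cols]
    have : Submodule.span ℝ (Set.range fun i : B => A.col i) = Submodule.span ℝ (Set.range A.col) := by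
      apply le_antisymm
      · apply Submodule.span_mono
        rintro _ ⟨i, rfl⟩
        exact ⟨i, rfl⟩
      · rw [Submodule.span_le, ← Set.image_univ]
        refine hspan.trans ?_
        rw [Set.image_eq_range]
    rw [this]
  let e : Fin r ≃ B := (Fintype.equivFinOfCardEq hcard).symm
  let g : Fin r → Fin n := fun k => (e k : Fin n)
  have hg : Function.Injective g := Subtype.val_injective.comp e.injective
  have hM : IsUnit (A.submatrix id g) := by
    rw [← linearIndependent_cols_iff_isUnit]
    exact hB.comp e e.injective
  have hdet : (A.submatrix id g).det ≠ 0 := by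
    have := (Matrix.isUnit_iff_isUnit_det _).1 hM
    exact this.ne_zero
  let w : Fin n → ℝ := v - Pi.single j0 (v j0)
  have hw : ∀ i, i ∉ Set.range g → w i = 0 := by
    intro i hi
    by_cases h : i = j0
    · subst h; simp [w]
    · have : v i = 0 := by
        by_contra hvi
        have : i ∈ B := hSB ⟨hvi, h⟩
        exact hi ⟨e.symm ⟨i, this⟩, by simp [g]⟩
      simp [w, h, this]
  have hMx : (A.submatrix id g) *ᵥ (w ∘ g) = (-v j0) • A.col j0 := by
    have h1 : (A.submatrix id g) *ᵥ (w ∘ g) = A *ᵥ w := by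
      ext i
      simp only [Matrix.mulVec, dotProduct]
      apply Fintype.sum_of_injective g hg
      · intro k hk; rw [hw k hk, mul_zero]
      · intro k; rfl
    rw [h1]
    simp only [w]
    rw [Matrix.mulVec_sub, hAv]
    ext i
    simp [mul_comm]
  have hjB : j ∈ B := hSB ⟨hj, hjj⟩
  obtain ⟨k, hk⟩ : ∃ k, g k = j := ⟨e.symm ⟨j, hjB⟩, by simp [g]⟩
  have hcr : cramer (A.submatrix id g) ((A.submatrix id g) *ᵥ (w ∘ g)) k
      = (A.submatrix id g).det * v j := by
    rw [cramer_eq_adjugate_mulVec, Matrix.mulVec_mulVec, adjugate_mul]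
    simp [Matrix.smul_mulVec, w, hk, hjj]
  have hup : (A.submatrix id g).updateCol k (A.col j0)
      = A.submatrix id (Function.update g k j0) := by
    ext a b
    by_cases h : b = k
    · subst h; simp
    · simp [h]
  rw [hMx, map_smul, Pi.smul_apply, cramer_apply, hup, smul_eq_mul] at hcr
  have hs := (isTotallyUnimodular_iff_fintype A).1 hTU
  obtain ⟨a, ha⟩ := hs (Fin r) id g
  obtain ⟨b, hb⟩ := hs (Fin r) id (Function.update g k j0)
  rw [← ha] at hdet hcr
  rw [← hb] at hcr
  rcases a with _ | _ | _ <;> rcases b with _ | _ | _ <;> simp at hdet hcr <;>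
    first
    | (exfalso; tauto)
    | (rw [← hcr]; simp; done)
    | (rw [hcr]; done)
    | (rw [← hcr]; done)
    | (rw [hcr]; simp; done)

theorem aux_sgn {r n : ℕ} (A : Matrix (Fin r) (Fin n) ℝ)
    (hTU : A.IsTotallyUnimodular) (hrank : A.rank = r) (v : Fin n → ℝ)
    (hv : IsSupportMinimalKer A v) :
    ∃ t : ℝ, t ≠ 0 ∧ v = t • (fun i => ((sgn (v i) : ℤ) : ℝ)) := by
  obtain ⟨j0, h0⟩ := Function.ne_iff.1 hv.1
  refine ⟨|v j0|, by simpa using h0, ?_⟩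
  ext i
  by_cases hi : v i = 0
  · simp [hi, sgn]
  · have := aux_abs A hTU hrank v hv j0 i h0 hi
    simp only [Pi.smul_apply, smul_eq_mul, ← this, sgn]
    rcases lt_or_gt_of_ne hi with h | h
    · simp [h, h.le, not_lt.2 h.le, abs_of_neg h]
    · simp [h, abs_of_pos h]

open Matrix in
theorem aux_span_s10 {r n : ℕ} (A : Matrix (Fin r) (Fin n) ℝ) (N : ℕ) :
    ∀ v : Fin n → ℝ, A *ᵥ v = 0 → (Function.support v).ncard ≤ N →
      v ∈ Submodule.span ℝ {w | IsSupportMinimalKer A w} := by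
  induction N with
  | zero =>
    intro v _ h
    have : v = 0 := by
      rw [Nat.le_zero, Set.ncard_eq_zero, Function.support_eq_empty_iff] at h
      exact h
    rw [this]; exact zero_mem _
  | succ N ih =>
    intro v hv h
    by_cases hv0 : v = 0
    · rw [hv0]; exact zero_mem _
    by_cases hm : IsSupportMinimalKer A v
    · exact Submodule.subset_span hm
    · have : ∃ w : Fin n → ℝ, w ≠ 0 ∧ A *ᵥ w = 0 ∧ Function.support w ⊂ Function.support v := by
        by_contra hcon
        push Not at hcon
        exact hm ⟨hv0, hv, hcon⟩
      obtain ⟨w, hw0, hw, hlt⟩ := this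
      obtain ⟨i, hi⟩ := Function.ne_iff.1 hw0
      have hi' : w i ≠ 0 := hi
      have hws : w ∈ Submodule.span ℝ {w | IsSupportMinimalKer A w} := by
        apply ih w hw
        have := Set.ncard_lt_ncard hlt
        omega
      have hu : v - (v i / w i) • w ∈ Submodule.span ℝ {w | IsSupportMinimalKer A w} := by
        apply ih
        · rw [Matrix.mulVec_sub, Matrix.mulVec_smul, hv, hw]; simp
        · have hss : Function.support (v - (v i / w i) • w) ⊂ Function.support v := by
            refine ⟨fun k hk => ?_, fun hh => ?_⟩
            · intro hvk
              have hwk : w k = 0 := by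
                by_contra hc
                exact hlt.1 hc hvk
              apply hk
              simp [hvk, hwk]
            · have : i ∈ Function.support (v - (v i / w i) • w) := hh (hlt.1 hi')
              apply this
              simp [hi']
          have := Set.ncard_lt_ncard hss
          omega
      have := add_mem hu (Submodule.smul_mem _ (v i / w i) hws)
      simpa using this

/-- Let `A` be a totally unimodular real `r × n` matrix of rank `r`.  Then the
circuit lattice `Λσ(A)` has rank exactly `n - r`; that is, the irregularity parameter
satisfies `ρ(A) = 0`. -/
theorem statement10 {r n : ℕ} (A : Matrix (Fin r) (Fin n) ℝ)
    (hTU : A.IsTotallyUnimodular) (hrank : A.rank = r) :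
    Module.finrank ℤ (circLat A) = n - r := by
  classical
  let b := Module.Free.chooseBasis ℤ (circLat A)
  let φ : (Fin n → ℤ) → (Fin n → ℝ) := fun c => algebraMap ℤ ℝ ∘ c
  have hli : LinearIndependent ℤ (fun i => ((b i : circLat A) : Fin n → ℤ)) :=
    b.linearIndependent.map' (circLat A).subtype (Submodule.ker_subtype _)
  have hliR : LinearIndependent ℝ (fun i => φ (b i)) :=
    linearIndependent_algebraMap_comp_iff.2 hli
  let f : (Fin n → ℤ) →ₗ[ℤ] (Fin n → ℝ) := (Algebra.linearMap ℤ ℝ).compLeft (Fin n)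
  have hfφ : ∀ c, f c = φ c := fun c => rfl
  have hspan : Submodule.span ℝ (Set.range fun i => φ (b i)) = LinearMap.ker A.mulVecLin := by
    apply le_antisymm
    · have hle : circLat A ≤ ((LinearMap.ker A.mulVecLin).restrictScalars ℤ).comap f := by
        rw [circLat, Submodule.span_le]
        rintro _ ⟨v, hv, rfl⟩
        obtain ⟨t, ht, hvt⟩ := aux_sgn A hTU hrank v hv
        have h2 := hv.2.1
        rw [hvt, Matrix.mulVec_smul, smul_eq_zero] at h2
        exact h2.resolve_left ht
      rw [Submodule.span_le]
      rintro _ ⟨i, rfl⟩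
      exact hle (b i).2
    · have hle : circLat A ≤
          ((Submodule.span ℝ (Set.range fun i => φ (b i))).restrictScalars ℤ).comap f := by
        intro c hc
        have h1 := b.sum_repr ⟨c, hc⟩
        have h2 := congrArg (fun x : circLat A => f x) h1
        simp only [Submodule.coe_sum, map_sum, Submodule.coe_smul, map_smul] at h2
        rw [Submodule.mem_comap, ← h2]
        refine Submodule.sum_mem _ fun i _ => Submodule.smul_mem _ _ ?_
        exact Submodule.subset_span ⟨i, rfl⟩
      intro v hv
      have h1 := aux_span_s10 A _ v hv le_rfl
      refine (Submodule.span_le.2 ?_) h1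
      intro w hw
      obtain ⟨t, ht, hwt⟩ := aux_sgn A hTU hrank w hw
      rw [hwt]
      refine Submodule.smul_mem _ _ ?_
      exact hle (Submodule.subset_span ⟨w, hw, rfl⟩)
  have h1 := finrank_span_eq_card hliR
  rw [hspan] at h1
  have h2 := A.mulVecLin.finrank_range_add_finrank_ker
  rw [Module.finrank_eq_card_chooseBasisIndex, ← h1]
  have h3 : Module.finrank ℝ (LinearMap.range A.mulVecLin) = r := hrank
  rw [h3] at h2
  simp at h2 ⊢
  omega
end
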